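/- Undecidability of CFG equivalence: for any terminal alphabet T with at least two symbols, there is no algorithm that, given (codes of) two context-free grammars G and G' over T, decides whether the language generated by G equals the language generated by G'; formally, the predicate on pairs of (suitably encoded) context-free grammars 'G and G' generate the same language' is not decidable. -/

import Mathlib

/-- A context-free grammar over a terminal alphabet `T`, with nonterminals drawn
from `ℕ`: an initial nonterminal and a finite list of productions `N → w`,
where `w` is a string over nonterminals and terminals. -/
structure CFG (T : Type) where
  initial : ℕ
  rules : List (ℕ × List (ℕ ⊕ T))

namespace CFG

variable {T : Type}

/-- One rewriting step: replace an occurrence of a nonterminal by the right-hand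
side of one of its productions. -/
def Rewrite (G : CFG T) (u v : List (ℕ ⊕ T)) : Prop :=
  ∃ (p q : List (ℕ ⊕ T)) (N : ℕ) (w : List (ℕ ⊕ T)),
    (N, w) ∈ G.rules ∧ u = p ++ Sum.inl N :: q ∧ v = p ++ w ++ q

/-- Derivability: the reflexive-transitive closure of rewriting. -/
def Derives (G : CFG T) : List (ℕ ⊕ T) → List (ℕ ⊕ T) → Prop :=
  Relation.ReflTransGen (Rewrite G)

/-- The language of a grammar: the terminal strings derivable from the initial
nonterminal. -/
def language (G : CFG T) : Set (List T) :=
  {s | Derives G [Sum.inl G.initial] (s.map Sum.inr)}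

/-- A natural effective encoding of context-free grammars as natural numbers. -/
def enc [Encodable T] (G : CFG T) : ℕ :=
  Nat.pair G.initial (Encodable.encode G.rules)

end CFG

/-- The halting problem for a fixed code whose inputs are powers of two. -/
theorem exists_code_halting_two_pow : ∃ c : Turing.ToPartrec.Code,
    ¬ ComputablePred fun n : ℕ => (c.eval [2 ^ n]).Dom := by
  have hpart : Partrec fun n : ℕ =>
      ((Denumerable.ofNat Nat.Partrec.Code n).eval 0 : Part ℕ) :=
    Nat.Partrec.Code.eval_part.comp (Computable.ofNat _) (Computable.const 0)
  have hundec : ¬ ComputablePred fun n : ℕ =>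
      ((Denumerable.ofNat Nat.Partrec.Code n).eval 0).Dom := fun h =>
    ComputablePred.halting_problem 0
      (ComputablePred.computable_of_manyOneReducible
        (p := fun c : Nat.Partrec.Code => (c.eval 0).Dom)
        ⟨Encodable.encode, Computable.encode, fun c => by simp⟩ h)
  have hpow : Primrec₂ fun m k : ℕ => decide (2 ^ k = m) := by
    have h2 : Primrec₂ fun m k : ℕ => 2 ^ k :=
      (Primrec₂.unpaired'.1 Nat.Primrec.pow).comp (Primrec.const 2) Primrec.snd
    exact (PrimrecRel.decide Primrec.eq).comp h2 Primrec.fst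
  have hlog : Partrec fun m : ℕ => Nat.rfind fun k => Part.some (decide (2 ^ k = m)) :=
    Partrec.rfind hpow.to_comp
  have hg : Partrec fun m : ℕ => (Nat.rfind fun k => Part.some (decide (2 ^ k = m))).bind
      fun n => ((Denumerable.ofNat Nat.Partrec.Code n).eval 0 : Part ℕ) :=
    hlog.bind (hpart.comp Computable.snd)
  obtain ⟨c, hc⟩ := Turing.ToPartrec.Code.exists_code (Nat.Partrec'.part_iff₁.2 hg)
  refine ⟨c, fun h => hundec ?_⟩
  refine ComputablePred.of_eq h fun n => ?_
  have := hc ⟨[2 ^ n], rfl⟩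
  have hr : (Nat.rfind fun k => Part.some (decide (2 ^ k = 2 ^ n))) = Part.some n := by
    refine Part.eq_some_iff.2 (Nat.mem_rfind.2 ⟨by simp, fun {m} hm => ?_⟩)
    simp [hm.ne]
  change c.eval [2 ^ n] = _ at this
  rw [this]
  change (pure <$> (Nat.rfind fun k => Part.some (decide (2 ^ k = 2 ^ n))).bind _).Dom ↔ _
  rw [hr]
  simp

namespace Turing

open StateTransition PartrecToTM2

theorem trNat_two_pow (n : ℕ) :
    trNat (2 ^ n) = List.replicate n Γ'.bit0 ++ [Γ'.bit1] := by
  suffices h : ∃ p : PosNum, ((2 ^ n : ℕ) : Num) = Num.pos p ∧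
      trPosNum p = List.replicate n Γ'.bit0 ++ [Γ'.bit1] by
    obtain ⟨p, hp, h⟩ := h
    rw [trNat, hp, trNum, h]
  induction n with
  | zero => exact ⟨1, rfl, rfl⟩
  | succ n ih =>
    obtain ⟨p, hp, h⟩ := ih
    refine ⟨p.bit0, ?_, ?_⟩
    · rw [pow_succ, mul_two, Nat.cast_add, hp]
      exact Num.bit0_of_bit0 _
    · simp [trPosNum, h, List.replicate_succ]

instance : Finite K' :=
  Finite.of_surjective (fun p : Bool × Bool => match p with
    | (true, true) => K'.main | (true, false) => K'.rev
    | (false, true) => K'.aux | (false, false) => K'.stack)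
    (by rintro (_ | _ | _ | _) <;> simp)

/-- There is a finite Post-Turing machine whose halting problem is undecidable on the inputs
`x y z ⋯ z`. -/
theorem exists_tm0_halting : ∃ (Γ Λ : Type) (_ : Finite Γ) (_ : Finite Λ) (_ : Inhabited Γ)
    (_ : Inhabited Λ) (M : TM0.Machine Γ Λ) (x y z : Γ),
    ¬ ComputablePred fun n : ℕ =>
      (eval (TM0.step M) (TM0.init (x :: y :: List.replicate n z))).Dom := by
  obtain ⟨c, hc⟩ := exists_code_halting_two_pow
  let : Inhabited Λ' := ⟨PartrecToTM2.trNormal c Cont'.halt⟩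
  have hinit (n : ℕ) : PartrecToTM2.init c [2 ^ n] =
      (TM2.init K'.main (List.replicate n Γ'.bit0 ++ [Γ'.bit1, Γ'.cons]) :
        TM2.Cfg (fun _ : K' => Γ') Λ' (Option Γ')) := by
    unfold PartrecToTM2.init TM2.init
    congr 1
    funext k
    cases k <;> simp [trNat_two_pow]
  let M₁ := TM2to1.tr PartrecToTM2.tr
  let M₀ := TM1to0.tr M₁
  have hsupp : TM0.Supports M₀ (TM1to0.trStmts M₁
      (TM2to1.trSupp PartrecToTM2.tr (codeSupp c Cont'.halt)) : Set _) :=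
    TM1to0.tr_supports _ (TM2to1.tr_supports _ (PartrecToTM2.tr_supports c Cont'.halt))
  let S : Set (TM1to0.Λ' M₁) := TM1to0.trStmts M₁
    (TM2to1.trSupp PartrecToTM2.tr (codeSupp c Cont'.halt))
  have hS : S.Finite := Finset.finite_toSet _
  have : Fintype K' := Fintype.ofFinite _
  classical
  let : Inhabited S := ⟨⟨default, hsupp.1⟩⟩
  let g : PointedMap (TM1to0.Λ' M₁) S :=
    ⟨fun q => if h : q ∈ S then ⟨q, h⟩ else default, by
      rw [dif_pos hsupp.1]; rfl⟩
  let i : PointedMap (TM2to1.Γ' K' fun _ => Γ') (TM2to1.Γ' K' fun _ => Γ') := ⟨id, rfl⟩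
  have hg : ∀ q ∈ S, ((g q : S) : TM1to0.Λ' M₁) = q := fun q hq => by
    change ((if h : q ∈ S then (⟨q, h⟩ : S) else default : S) : TM1to0.Λ' M₁) = q
    rw [dif_pos hq]
  have hresp := TM0.Machine.map_respects M₀ i i g Subtype.val hsupp (fun _ => rfl) hg
  let w (b : Bool) (o : Γ') : TM2to1.Γ' K' fun _ => Γ' :=
    (b, Function.update (fun _ => none) K'.main (some o))
  refine ⟨TM2to1.Γ' K' fun _ => Γ', S, inferInstance, hS, inferInstance, inferInstance,
    M₀.map i i g Subtype.val, w true Γ'.cons, w false Γ'.bit1, w false Γ'.bit0,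
    fun h => hc (h.of_eq fun n => ?_)⟩
  have htape : TM2to1.trInit (Γ := fun _ => Γ') K'.main
      (List.replicate n Γ'.bit0 ++ [Γ'.bit1, Γ'.cons]) =
      w true Γ'.cons :: w false Γ'.bit1 :: List.replicate n (w false Γ'.bit0) := by
    have hrev : (List.replicate n Γ'.bit0 ++ [Γ'.bit1, Γ'.cons]).reverse =
        Γ'.cons :: Γ'.bit1 :: List.replicate n Γ'.bit0 := by simp
    unfold TM2to1.trInit
    rw [hrev]
    change _ :: _ :: List.map (w false) (List.replicate n Γ'.bit0) = _
    rw [List.map_replicate]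
    rfl
  rw [← htape]
  set l := TM2to1.trInit (Γ := fun _ => Γ') K'.main
      (List.replicate n Γ'.bit0 ++ [Γ'.bit1, Γ'.cons]) with hl
  have h₀ : (eval (TM0.step (M₀.map i i g Subtype.val)) (TM0.init l)).Dom ↔
      (eval (TM0.step M₀) (TM0.init l)).Dom := by
    refine tr_eval_dom hresp ⟨hsupp.1, ?_⟩
    rw [TM0.map_init]
    exact congrArg TM0.init (List.map_id l)
  have h₁ : (eval (TM0.step M₀) (TM0.init l)).Dom ↔ (eval (TM1.step M₁) (TM1.init l)).Dom :=
    tr_eval_dom (TM1to0.tr_respects M₁) rfl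
  have h₂ : (eval (TM1.step M₁) (TM1.init l)).Dom ↔
      (eval (TM2.step PartrecToTM2.tr) (PartrecToTM2.init c [2 ^ n])).Dom := by
    rw [hinit]
    exact tr_eval_dom (TM2to1.tr_respects _) (TM2to1.trCfg_init _ _)
  rw [h₀, h₁, h₂, PartrecToTM2.tr_eval]
  rfl

end Turing

/-- A queue machine: in a non-halting state it removes the front letter of its queue, appends a
word to the back and changes its state.  States without a transition are halting. -/
structure QueueMachine (α P : Type) where
  step : P → Option (α → List α × P)

namespace QueueMachine

open Turing StateTransition

/-- One step of a queue machine on a configuration. -/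
def next {α P : Type} (Q : QueueMachine α P) : P × List α → Option (P × List α)
  | (_, []) => none
  | (p, x :: u) => (Q.step p).map fun f => ((f x).2, u ++ (f x).1)

section General

variable {α P : Type} {Q : QueueMachine α P}

theorem mem_next {p : P} {f : α → List α × P} (h : Q.step p = some f) (x : α) (u : List α) :
    ((f x).2, u ++ (f x).1) ∈ Q.next (p, x :: u) := by
  simp [next, h]

theorem next_of_halting {p : P} (h : Q.step p = none) (u : List α) : Q.next (p, u) = none := by
  cases u <;> simp [next, h]

theorem reaches_trans {a b c : P × List α} (h : Reaches Q.next a b) (h' : Reaches Q.next b c) :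
    Reaches Q.next a c :=
  Relation.ReflTransGen.trans h h'

theorem reaches_head {a b c : P × List α} (h : b ∈ Q.next a) (h' : Reaches Q.next b c) :
    Reaches Q.next a c :=
  Relation.ReflTransGen.head h h'

theorem reaches₁_head {a b c : P × List α} (h : b ∈ Q.next a) (h' : Reaches Q.next b c) :
    Reaches₁ Q.next a c :=
  Relation.TransGen.head' h h'

theorem reaches₁_tail {a b c : P × List α} (h : Reaches Q.next a b) (h' : c ∈ Q.next b) :
    Reaches₁ Q.next a c :=
  Relation.TransGen.tail' h h'

theorem reaches_copy {β : Type} {p : P} {f : α → List α × P} (g : β → α) (h : Q.step p = some f)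
    (hf : ∀ b, f (g b) = ([g b], p)) (l : List β) (u : List α) :
    Reaches Q.next (p, l.map g ++ u) (p, u ++ l.map g) := by
  induction l generalizing u with
  | nil => simp; exact Relation.ReflTransGen.refl
  | cons b l ih =>
    have h₁ := mem_next h (g b) (l.map g ++ u)
    rw [hf] at h₁
    refine reaches_head h₁ ?_
    simpa using ih (u ++ [g b])

end General

/-! ### Simulating a Post-Turing machine -/

/-- The states of the queue machine simulating a Post-Turing machine.  The queue holds the left
half tape followed by the right half tape, both read from the head outwards and both terminated by
a separator, while the scanned symbol is part of the state. -/
inductive TapeState (Γ Λ : Type)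
  | start (q : Λ) (h : Γ)
  | scanLeft (q : Λ) (m : Option (Option Γ × Γ))
  | popRight (q : Λ)
  | scanRight (q : Λ) (h : Γ)

instance {Γ Λ : Type} [Finite Γ] [Finite Λ] : Finite (TapeState Γ Λ) :=
  Finite.of_surjective
    (fun s : (Λ × Γ) ⊕ (Λ × Option (Option Γ × Γ)) ⊕ Λ ⊕ (Λ × Γ) => match s with
      | .inl (q, h) => TapeState.start q h
      | .inr (.inl (q, m)) => TapeState.scanLeft q m
      | .inr (.inr (.inl q)) => TapeState.popRight q
      | .inr (.inr (.inr (q, h))) => TapeState.scanRight q h)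
    (by
      rintro (⟨q, h⟩ | ⟨q, m⟩ | q | ⟨q, h⟩)
      · exact ⟨.inl (q, h), rfl⟩
      · exact ⟨.inr (.inl (q, m)), rfl⟩
      · exact ⟨.inr (.inr (.inl q)), rfl⟩
      · exact ⟨.inr (.inr (.inr (q, h))), rfl⟩)

section Tape

variable {Γ Λ : Type} [Inhabited Γ] [Inhabited Λ]

open TapeState

/-- The first letter of a round, which executes the statement `s` with scanned symbol `h`. -/
def startStep (h : Γ) (q : Λ) : TM0.Stmt Γ → Option Γ → List (Option Γ) × TapeState Γ Λ
  | .write a, some y => ([some y], scanLeft q (some (none, a)))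
  | .write a, none => ([none], scanRight q a)
  | .move .left, some y => ([], scanLeft q (some (some h, y)))
  | .move .left, none => ([none, some h], scanRight q default)
  | .move .right, some y => ([some h, some y], scanLeft q none)
  | .move .right, none => ([some h, none], popRight q)

/-- The queue machine simulating a Post-Turing machine. -/
def ofTM0 (M : TM0.Machine Γ Λ) : QueueMachine (Option Γ) (TapeState Γ Λ) where
  step
    | start q h => (M q h).map fun s => startStep h s.1 s.2
    | scanLeft q (some (s, h)) => some fun
      | some y => ([some y], scanLeft q (some (s, h)))
      | none => (none :: s.toList.map some, scanRight q h)
    | scanLeft q none => some fun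
      | some y => ([some y], scanLeft q none)
      | none => ([none], popRight q)
    | popRight q => some fun
      | some y => ([], scanRight q y)
      | none => ([none], start q default)
    | scanRight q h => some fun
      | some y => ([some y], scanRight q h)
      | none => ([none], start q h)

/-- The queue contents representing two half tapes. -/
def tapeWord (L R : List Γ) : List (Option Γ) :=
  L.map some ++ none :: (R.map some ++ [none])

variable (M : TM0.Machine Γ Λ)

theorem scanRight_reaches (q : Λ) (h : Γ) (L R₁ R₂ : List Γ) :
    Reaches (ofTM0 M).next
      (scanRight q h, R₂.map some ++ none :: (L.map some ++ none :: R₁.map some))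
      (start q h, tapeWord L (R₁ ++ R₂)) := by
  refine reaches_trans (reaches_copy some (Q := ofTM0 M) (p := scanRight q h) rfl
    (fun _ => rfl) R₂ _) ?_
  refine Relation.ReflTransGen.single ?_
  have := mem_next (Q := ofTM0 M) (p := scanRight q h) rfl none
    ((L.map some ++ none :: R₁.map some) ++ R₂.map some)
  simpa [tapeWord] using this

theorem scanLeft_some_reaches (q : Λ) (s : Option Γ) (h : Γ) (L₁ L₂ R : List Γ) :
    Reaches (ofTM0 M).next
      (scanLeft q (some (s, h)), L₂.map some ++ none :: (R.map some ++ none :: L₁.map some))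
      (start q h, tapeWord (L₁ ++ L₂) (s.toList ++ R)) := by
  refine reaches_trans (reaches_copy some (Q := ofTM0 M) (p := scanLeft q (some (s, h))) rfl
    (fun _ => rfl) L₂ _) ?_
  refine reaches_head (mem_next (Q := ofTM0 M)
    (p := scanLeft q (some (s, h))) rfl none
    ((R.map some ++ none :: L₁.map some) ++ L₂.map some)) ?_
  simpa using scanRight_reaches M q h (L₁ ++ L₂) s.toList R

theorem popRight_reaches (q : Λ) (L R : List Γ) :
    Reaches (ofTM0 M).next (popRight q, R.map some ++ none :: (L.map some ++ [none]))
      (start q R.headI, tapeWord L R.tail) := by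
  cases R with
  | nil =>
    refine Relation.ReflTransGen.single ?_
    have := mem_next (Q := ofTM0 M) (p := popRight q) rfl none (L.map some ++ [none])
    simpa [tapeWord] using this
  | cons x R =>
    refine reaches_head (mem_next (Q := ofTM0 M) (p := popRight q) rfl (some x)
      (R.map some ++ none :: (L.map some ++ [none]))) ?_
    simpa using scanRight_reaches M q x L [] R

theorem scanLeft_none_reaches (q : Λ) (L₁ L₂ R : List Γ) :
    Reaches (ofTM0 M).next
      (scanLeft q none, L₂.map some ++ none :: (R.map some ++ none :: L₁.map some))
      (start q R.headI, tapeWord (L₁ ++ L₂) R.tail) := by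
  refine reaches_trans (reaches_copy some (Q := ofTM0 M) (p := scanLeft q none) rfl
    (fun _ => rfl) L₂ _) ?_
  refine reaches_head (mem_next (Q := ofTM0 M)
    (p := scanLeft q none) rfl none ((R.map some ++ none :: L₁.map some) ++ L₂.map some)) ?_
  simpa using popRight_reaches M q (L₁ ++ L₂) R

/-- The queue configurations representing a configuration of a Post-Turing machine. -/
def TapeRel (c : TM0.Cfg Γ Λ) (d : TapeState Γ Λ × List (Option Γ)) : Prop :=
  ∃ L R : List Γ, c.Tape.left = ListBlank.mk L ∧ c.Tape.right = ListBlank.mk R ∧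
    d = (start c.q c.Tape.head, tapeWord L R)

theorem ofTM0_respects : Respects (TM0.step M) (ofTM0 M).next TapeRel := by
  rintro ⟨q, ⟨h, _, _⟩⟩ _ ⟨L, R, rfl, rfl, rfl⟩
  cases hM : M q h with
  | none =>
    simp only [TM0.step, hM, Option.map_none]
    exact next_of_halting (by simp [ofTM0, hM]) _
  | some s =>
    obtain ⟨q', s⟩ := s
    have hs : (ofTM0 M).step (start q h) = some (startStep h q' s) := by simp [ofTM0, hM]
    simp only [TM0.step, hM, Option.map_some]
    obtain ⟨d | d⟩ | a := s
    · cases L with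
      | nil =>
        refine ⟨_, ⟨[], h :: R, by simp [Tape.move], by simp [Tape.move], rfl⟩,
          reaches₁_head (mem_next hs _ _) ?_⟩
        simpa [startStep, Tape.move] using scanRight_reaches M q' default [] [h] R
      | cons y L =>
        refine ⟨_, ⟨L, h :: R, by simp [Tape.move], by simp [Tape.move], rfl⟩,
          reaches₁_head (mem_next hs _ _) ?_⟩
        simpa [startStep, Tape.move] using scanLeft_some_reaches M q' (some h) y [] L R
    · refine ⟨_, ⟨h :: L, R.tail, by simp [Tape.move], by simp [Tape.move], rfl⟩, ?_⟩
      cases L with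
      | nil =>
        refine reaches₁_head (mem_next hs _ _) ?_
        simpa [startStep, Tape.move] using popRight_reaches M q' [h] R
      | cons y L =>
        refine reaches₁_head (mem_next hs _ _) ?_
        simpa [startStep, Tape.move] using scanLeft_none_reaches M q' [h, y] L R
    · refine ⟨_, ⟨L, R, by simp [Tape.write], by simp [Tape.write], rfl⟩, ?_⟩
      cases L with
      | nil =>
        refine reaches₁_head (mem_next hs _ _) ?_
        simpa [startStep, Tape.write] using scanRight_reaches M q' a [] [] R
      | cons y L =>
        refine reaches₁_head (mem_next hs _ _) ?_
        simpa [startStep, Tape.write] using scanLeft_some_reaches M q' none a [y] L R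

end Tape

/-! ### Binary queue alphabets -/

section Binary

variable {α P : Type} {m : ℕ} [NeZero m] (e : α ≃ Fin m)

/-- Unary coding of the letters of a finite alphabet. -/
def bits (x : α) : List Bool :=
  List.replicate (e x) true ++ [false]

/-- The queue machine over the binary alphabet that simulates `Q`. -/
def binary (Q : QueueMachine α P) : QueueMachine Bool (P × Fin m) where
  step s := (Q.step s.1).map fun f b =>
    if b then ([], (s.1, s.2 + 1))
    else ((f (e.symm s.2)).1.flatMap (bits e), ((f (e.symm s.2)).2, 0))

theorem binary_reaches_ones (Q : QueueMachine α P) {p : P} {f : α → List α × P}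
    (h : Q.step p = some f) (k i : ℕ) (u : List Bool) :
    Reaches (Q.binary e).next ((p, Fin.ofNat m i), List.replicate k true ++ u)
      ((p, Fin.ofNat m (i + k)), u) := by
  induction k generalizing i with
  | zero => exact Relation.ReflTransGen.refl
  | succ k ih =>
    refine reaches_head (b := ((p, Fin.ofNat m (i + 1)),
      List.replicate k true ++ u)) ?_ ?_
    · have hi : Fin.ofNat m i + 1 = Fin.ofNat m (i + 1) := by
        ext; simp only [Fin.val_add, Fin.val_ofNat, Fin.val_one', Nat.add_mod_mod, Nat.mod_add_mod]
      simp only [next, binary, h, List.replicate_succ, List.cons_append, Option.map_some, if_true,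
        hi, List.append_nil, Option.mem_def]
    · have := ih (i + 1)
      rwa [add_assoc, add_comm 1] at this

theorem binary_respects (Q : QueueMachine α P) : Respects Q.next (Q.binary e).next
    fun c d => d = ((c.1, 0), c.2.flatMap (bits e)) := by
  rintro ⟨p, u⟩ _ rfl
  cases h : Q.step p with
  | none =>
    rw [next_of_halting h]
    exact next_of_halting (by simp [binary, h]) _
  | some f =>
    cases u with
    | nil => simp [next]
    | cons x u =>
      simp only [next, h, Option.map_some]
      refine ⟨_, rfl, ?_⟩
      have h₁ := binary_reaches_ones e Q h (e x) 0 (false :: u.flatMap (bits e))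
      refine reaches₁_tail (b := ((p, e x), false :: u.flatMap (bits e))) ?_ ?_
      · simpa [bits] using h₁
      · simp [next, binary, h]

/-- Add a state that replaces each leading `true` of the queue by `v`, and the first `false`
by `w`, before entering the state `p`. -/
def withPrologue (Q : QueueMachine Bool P) (v w : List Bool) (p : P) :
    QueueMachine Bool (Option P) where
  step
    | none => some fun b => if b then (v, none) else (w, some p)
    | some q => (Q.step q).map fun f b => ((f b).1, some (f b).2)

theorem withPrologue_respects (Q : QueueMachine Bool P) (v w : List Bool) (p : P) :
    Respects Q.next (Q.withPrologue v w p).next fun c d => d = (some c.1, c.2) := by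
  rintro ⟨q, u⟩ _ rfl
  cases h : Q.step q with
  | none =>
    rw [next_of_halting h]
    exact next_of_halting (by simp [withPrologue, h]) _
  | some f =>
    cases u with
    | nil => simp [next]
    | cons x u =>
      simp only [next, h, Option.map_some]
      exact ⟨_, rfl, Relation.TransGen.single (by simp [next, withPrologue, h])⟩

theorem withPrologue_reaches (Q : QueueMachine Bool P) (v w : List Bool) (p : P) (n : ℕ) :
    Reaches (Q.withPrologue v w p).next (none, List.replicate n true ++ [false])
      (some p, (List.replicate n v).flatten ++ w) := by
  suffices h : ∀ u, Reaches (Q.withPrologue v w p).next (none, List.replicate n true ++ false :: u)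
      (some p, u ++ (List.replicate n v).flatten ++ w) from h []
  induction n with
  | zero =>
    exact fun u => Relation.ReflTransGen.single (by simp [next, withPrologue])
  | succ n ih =>
    refine fun u => reaches_head (b := (none, List.replicate n true ++
      false :: (u ++ v))) (by simp [next, withPrologue, List.replicate_succ]) ?_
    simpa [List.replicate_succ] using ih (u ++ v)

end Binary

/-- There is a finite binary queue machine whose halting problem is undecidable on the inputs
`1 ⋯ 1 0`, and which on these inputs never halts by emptying its queue. -/
theorem exists_halting : ∃ (P : Type) (_ : Finite P) (Q : QueueMachine Bool P) (p₀ : P),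
    (∀ n, (eval Q.next (p₀, List.replicate n true ++ [false])).Dom → ∃ p u,
      Reaches Q.next (p₀, List.replicate n true ++ [false]) (p, u) ∧ Q.step p = none) ∧
    ¬ ComputablePred fun n : ℕ =>
      (eval Q.next (p₀, List.replicate n true ++ [false])).Dom := by
  obtain ⟨Γ, Λ, _, _, _, _, M, x, y, z, hM⟩ := Turing.exists_tm0_halting
  have : NeZero (Nat.card (Option Γ)) := ⟨Nat.card_pos.ne'⟩
  let e : Option Γ ≃ Fin (Nat.card (Option Γ)) := Finite.equivFin _
  let w : List (Option Γ) := [none, none, some y]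
  let Q := ((ofTM0 M).binary e).withPrologue (bits e (some z)) (w.flatMap (bits e))
    (.scanRight default x, 0)
  have hstart (n : ℕ) : ∃ d, Reaches Q.next (none, List.replicate n true ++ [false]) d ∧
      ∃ c, (∃ b, TapeRel (TM0.init (x :: y :: List.replicate n z)) b ∧
        c = ((b.1, 0), b.2.flatMap (bits e))) ∧ d = (some c.1, c.2) := by
    let b : TapeState Γ Λ × List (Option Γ) :=
      (.start default x, tapeWord [] (y :: List.replicate n z))
    refine ⟨_, ?_, _, ⟨b, ⟨[], _, rfl, rfl, rfl⟩, rfl⟩, rfl⟩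
    refine reaches_trans (withPrologue_reaches _ _ _ _ n) ?_
    have h₁ := scanRight_reaches M default x [] [y] (List.replicate n z)
    obtain ⟨_, rfl, h₂⟩ := tr_reaches (binary_respects e (ofTM0 M)) rfl h₁
    obtain ⟨_, rfl, h₃⟩ := tr_reaches (withPrologue_respects ((ofTM0 M).binary e)
      (bits e (some z)) (w.flatMap (bits e)) (.scanRight default x, 0)) rfl h₂
    simpa [Q, w, b, List.flatMap] using h₃
  have hdom (n : ℕ) : (eval Q.next (none, List.replicate n true ++ [false])).Dom ↔
      (eval (TM0.step M) (TM0.init (x :: y :: List.replicate n z))).Dom := by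
    obtain ⟨d, hd, c, ⟨b, hb, hc⟩, rfl⟩ := hstart n
    rw [reaches_eval hd, tr_eval_dom (withPrologue_respects _ _ _ _) rfl,
      tr_eval_dom (binary_respects e (ofTM0 M)) hc, tr_eval_dom (ofTM0_respects M) hb]
  refine ⟨_, inferInstance, Q, none, fun n hn => ?_, fun h => hM (h.of_eq hdom)⟩
  rw [hdom, Part.dom_iff_mem] at hn
  obtain ⟨a, ha⟩ := hn
  obtain ⟨d, hd, c, ⟨b, hb, hc⟩, hdc⟩ := hstart n
  have hhalt := (mem_eval.1 ha).2
  obtain ⟨b', ⟨L, R, -, -, rfl⟩, hb'⟩ := tr_eval (ofTM0_respects M) hb ha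
  obtain ⟨_, rfl, hc'⟩ := tr_eval (binary_respects e (ofTM0 M)) hc hb'
  obtain ⟨_, rfl, hd'⟩ := tr_eval (withPrologue_respects _ _ _ _) hdc hc'
  refine ⟨_, _, hd.trans (mem_eval.1 hd').1, ?_⟩
  have : M a.q a.Tape.head = none := by simpa [TM0.step] using hhalt
  simp [Q, withPrologue, binary, ofTM0, this]

end QueueMachine

namespace CFG

variable {T : Type} {G : CFG T}

/-- The language of a sentential form whose nonterminals are interpreted by languages. -/
def formLanguage (L : ℕ → Language T) (u : List (ℕ ⊕ T)) : Language T :=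
  (u.map (Sum.elim L fun a => {[a]})).prod

theorem formLanguage_append (L : ℕ → Language T) (u v : List (ℕ ⊕ T)) :
    formLanguage L (u ++ v) = formLanguage L u * formLanguage L v := by
  simp [formLanguage]

theorem mem_formLanguage_map_inr_append (L : ℕ → Language T) (w v : List T) (u : List (ℕ ⊕ T)) :
    v ∈ formLanguage L (w.map Sum.inr ++ u) ↔ ∃ v' ∈ formLanguage L u, v = w ++ v' := by
  induction w generalizing v with
  | nil => simp
  | cons a w ih =>
    have h : formLanguage L ((a :: w).map Sum.inr ++ u) =
        ({[a]} : Language T) * formLanguage L (w.map Sum.inr ++ u) := by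
      simp [formLanguage]
    rw [h, Language.mem_mul]
    constructor
    · rintro ⟨_, rfl, v₂, h₂, rfl⟩
      obtain ⟨v', h', rfl⟩ := (ih v₂).1 h₂
      exact ⟨v', h', rfl⟩
    · rintro ⟨v', h', rfl⟩
      exact ⟨[a], rfl, _, (ih _).2 ⟨v', h', rfl⟩, rfl⟩

theorem mem_formLanguage_map_inr (L : ℕ → Language T) (w v : List T) :
    v ∈ formLanguage L (w.map Sum.inr) ↔ v = w := by
  simpa [formLanguage] using mem_formLanguage_map_inr_append L w v []

theorem formLanguage_singleton_inl (L : ℕ → Language T) (N : ℕ) :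
    formLanguage L [Sum.inl N] = L N := by
  simp [formLanguage]

theorem Derives.formLanguage_le {L : ℕ → Language T}
    (hL : ∀ r ∈ G.rules, formLanguage L r.2 ≤ L r.1) {u v : List (ℕ ⊕ T)} (h : G.Derives u v) :
    formLanguage L v ≤ formLanguage L u := by
  induction h with
  | refl => exact le_rfl
  | tail _ hs ih =>
    obtain ⟨p, q, N, w, hr, rfl, rfl⟩ := hs
    refine le_trans ?_ ih
    rw [← List.singleton_append, ← List.append_assoc]
    simp only [formLanguage_append, formLanguage_singleton_inl]
    exact mul_le_mul' (mul_le_mul' le_rfl (hL _ hr)) le_rfl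

theorem language_le {L : ℕ → Language T} (hL : ∀ r ∈ G.rules, formLanguage L r.2 ≤ L r.1) :
    G.language ⊆ L G.initial := by
  intro s hs
  have := Derives.formLanguage_le hL hs ((mem_formLanguage_map_inr L s s).2 rfl)
  rwa [formLanguage_singleton_inl] at this

theorem Derives.of_rule {N : ℕ} {w : List (ℕ ⊕ T)} (h : (N, w) ∈ G.rules) :
    G.Derives [Sum.inl N] w :=
  Relation.ReflTransGen.single ⟨[], [], N, w, h, rfl, by simp⟩

theorem Derives.trans {u v w : List (ℕ ⊕ T)} (h : G.Derives u v) (h' : G.Derives v w) :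
    G.Derives u w :=
  Relation.ReflTransGen.trans h h'

theorem Derives.context {u v : List (ℕ ⊕ T)} (h : G.Derives u v) (p q : List (ℕ ⊕ T)) :
    G.Derives (p ++ u ++ q) (p ++ v ++ q) := by
  induction h with
  | refl => exact Relation.ReflTransGen.refl
  | tail _ hs ih =>
    refine ih.tail ?_
    obtain ⟨p', q', N, w, hr, rfl, rfl⟩ := hs
    exact ⟨p ++ p', q' ++ q, N, w, hr, by simp, by simp⟩

end CFG

/-- A deterministic automaton that consumes a binary word from both ends: in each state it reads
either the first or the last letter of the remaining word. -/
structure LinearAutomaton (Q : Type) where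
  right : Q → Bool
  next : Q → Bool → Q
  final : Q → Prop

namespace LinearAutomaton

variable {Q : Type} (A : LinearAutomaton Q)

/-- The state reached after consuming the whole word. -/
def run (q : Q) (w : List Bool) : Q :=
  if h : w = [] then q
  else if A.right q then run (A.next q (w.getLast h)) w.dropLast
  else run (A.next q (w.head h)) w.tail
termination_by w.length
decreasing_by
  all_goals
    have := List.length_pos_of_ne_nil h
    simp
    omega

@[simp]
theorem run_nil (q : Q) : A.run q [] = q := by
  rw [run]
  simp

theorem run_cons {q : Q} (h : A.right q = false) (x : Bool) (w : List Bool) :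
    A.run q (x :: w) = A.run (A.next q x) w := by
  rw [run]
  simp [h]

theorem run_concat {q : Q} (h : A.right q = true) (x : Bool) (w : List Bool) :
    A.run q (w ++ [x]) = A.run (A.next q x) w := by
  rw [run]
  simp [h]

section Grammar

open Sum Classical

variable {T : Type} (t : Bool → T) (e : Q → ℕ)

/-- The right-hand side of the production simulating the transition from `q` reading `x`. -/
noncomputable def rhs (q : Q) (x : Bool) : List (ℕ ⊕ T) :=
  if A.right q then [inl (e (A.next q x) + 1), inr (t x)] else [inr (t x), inl (e (A.next q x) + 1)]

/-- The productions generating, from each state in `S`, the words that are rejected. -/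
noncomputable def productions (S : Finset Q) : List (ℕ × List (ℕ ⊕ T)) :=
  S.toList.flatMap fun q => [(e q + 1, A.rhs t e q true), (e q + 1, A.rhs t e q false)] ++
    if A.final q then [] else [(e q + 1, [])]

/-- The production replacing the initial nonterminal `0` by a word followed by a state. -/
def initialProduction (i : List Bool × Q) : ℕ × List (ℕ ⊕ T) :=
  (0, (i.1.map t).map inr ++ [inl (e i.2 + 1)])

/-- The grammar generating the words `u ++ w` with `(u, q)` in `I` and `w` rejected from `q`. -/
noncomputable def grammar (S : Finset Q) (I : List (List Bool × Q)) : CFG T :=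
  ⟨0, I.map (initialProduction t e) ++ A.productions t e S⟩

variable {t e} {A}

theorem derives_of_not_final {G : CFG T} {S : Finset Q} (hS : ∀ q ∈ S, ∀ x, A.next q x ∈ S)
    (hG : A.productions t e S ⊆ G.rules) (n : ℕ) :
    ∀ w : List Bool, w.length = n → ∀ q ∈ S, ¬ A.final (A.run q w) →
      G.Derives [inl (e q + 1)] ((w.map t).map inr) := by
  have hmem : ∀ q ∈ S, ∀ x, (e q + 1, A.rhs t e q x) ∈ G.rules := by
    intro q hq x
    refine hG (List.mem_flatMap.2 ⟨q, Finset.mem_toList.2 hq, ?_⟩)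
    cases x <;> simp
  induction n with
  | zero =>
    intro w hw q hq hf
    obtain rfl := List.length_eq_zero_iff.1 hw
    refine CFG.Derives.of_rule (hG (List.mem_flatMap.2 ⟨q, Finset.mem_toList.2 hq, ?_⟩))
    rw [run_nil] at hf
    simp [hf]
  | succ n ih =>
    intro w hw q hq hf
    cases hr : A.right q with
    | false =>
      obtain ⟨x, w, rfl⟩ := List.exists_cons_of_length_eq_add_one hw
      rw [A.run_cons hr] at hf
      refine (CFG.Derives.of_rule (hmem q hq x)).trans ?_
      simpa [rhs, hr] using
        (ih w (by simpa using hw) _ (hS q hq x) hf).context [inr (t x)] []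
    | true =>
      have hne : w ≠ [] := by rintro rfl; simp at hw
      obtain ⟨w, x, rfl⟩ := List.eq_nil_or_concat w |>.resolve_left hne
      rw [List.concat_eq_append] at hw hf ⊢
      rw [A.run_concat hr] at hf
      refine (CFG.Derives.of_rule (hmem q hq x)).trans ?_
      simpa [rhs, hr] using
        (ih w (by simpa using hw) _ (hS q hq x) hf).context [] [inr (t x)]

variable (A t) in
/-- The interpretation of the nonterminals of `LinearAutomaton.grammar`. -/
def nonterminalLanguage (e : Q → ℕ) (I : List (List Bool × Q)) : ℕ → Language T
  | 0 => {v | ∃ i ∈ I, ∃ w, v = (i.1 ++ w).map t ∧ ¬ A.final (A.run i.2 w)}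
  | k + 1 => {v | ∃ q, e q = k ∧ ∃ w, v = w.map t ∧ ¬ A.final (A.run q w)}

theorem language_grammar (he : Function.Injective e) {S : Finset Q}
    (hS : ∀ q ∈ S, ∀ x, A.next q x ∈ S) {I : List (List Bool × Q)} (hI : ∀ i ∈ I, i.2 ∈ S) :
    (A.grammar t e S I).language =
      {v | ∃ i ∈ I, ∃ w, v = (i.1 ++ w).map t ∧ ¬ A.final (A.run i.2 w)} := by
  apply Set.Subset.antisymm
  · refine CFG.language_le (G := A.grammar t e S I) (L := A.nonterminalLanguage t e I) ?_
    intro r hr v hv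
    rcases List.mem_append.1 hr with hr | hr
    · obtain ⟨i, hi, rfl⟩ := List.mem_map.1 hr
      obtain ⟨v', hv', rfl⟩ := (CFG.mem_formLanguage_map_inr_append _ _ _ _).1 hv
      rw [CFG.formLanguage_singleton_inl] at hv'
      obtain ⟨q, hq, w, rfl, hw⟩ := hv'
      obtain rfl := he hq
      exact ⟨i, hi, w, by simp, hw⟩
    · obtain ⟨q, -, hr⟩ := List.mem_flatMap.1 hr
      have hstep : ∀ x, v ∈ CFG.formLanguage (A.nonterminalLanguage t e I) (A.rhs t e q x) →
          v ∈ A.nonterminalLanguage t e I (e q + 1) := by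
        intro x hv
        cases hq : A.right q with
        | false =>
          have h : A.rhs t e q x = [t x].map inr ++ [inl (e (A.next q x) + 1)] := by
            simp [rhs, hq]
          rw [h] at hv
          obtain ⟨v', hv', rfl⟩ := (CFG.mem_formLanguage_map_inr_append _ _ _ _).1 hv
          rw [CFG.formLanguage_singleton_inl] at hv'
          obtain ⟨q', hq', w, rfl, hw⟩ := hv'
          obtain rfl := he hq'
          exact ⟨q, rfl, x :: w, by simp, by rwa [A.run_cons hq]⟩
        | true =>
          have h : A.rhs t e q x = [inl (e (A.next q x) + 1)] ++ [t x].map inr := by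
            simp [rhs, hq]
          rw [h, CFG.formLanguage_append, CFG.formLanguage_singleton_inl, Language.mem_mul] at hv
          obtain ⟨_, ⟨q', hq', w, rfl, hw⟩, v₂, hv₂, rfl⟩ := hv
          rw [CFG.mem_formLanguage_map_inr] at hv₂
          obtain rfl := he hq'
          exact ⟨q, rfl, w ++ [x], by simp [hv₂], by rwa [A.run_concat hq]⟩
      by_cases hf : A.final q
      · simp only [hf, if_true, List.append_nil, List.mem_cons, List.not_mem_nil, or_false] at hr
        rcases hr with rfl | rfl
        exacts [hstep _ hv, hstep _ hv]
      · simp only [hf, if_false, List.mem_cons, List.cons_append, List.nil_append,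
          List.not_mem_nil, or_false] at hr
        rcases hr with rfl | rfl | rfl
        · exact hstep _ hv
        · exact hstep _ hv
        · refine ⟨q, rfl, [], ?_, by simpa using hf⟩
          exact (CFG.mem_formLanguage_map_inr (A.nonterminalLanguage t e I) [] v).1 hv
  · rintro _ ⟨i, hi, w, rfl, hw⟩
    have h₁ : (A.grammar t e S I).Derives [inl 0] ((i.1.map t).map inr ++ [inl (e i.2 + 1)]) :=
      CFG.Derives.of_rule (List.mem_append_left _ (List.mem_map_of_mem hi))
    have h₂ := (derives_of_not_final (G := A.grammar t e S I) hS
      (fun r hr => List.mem_append_right _ hr) _ w rfl i.2 (hI i hi) hw).context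
      ((i.1.map t).map inr) []
    have := h₁.trans (by simpa using h₂)
    simpa [CFG.language, grammar] using this

end Grammar

end LinearAutomaton

namespace QueueMachine

open Turing StateTransition

variable {P : Type} (Q : QueueMachine Bool P)

/-- The word appended to the queue when the machine, started in the state `p`, removes the letters
of `z` one after the other; halting states append nothing. -/
def output : P → List Bool → List Bool
  | _, [] => []
  | p, x :: z =>
    match Q.step p with
    | none => output p z
    | some f => (f x).1 ++ output (f x).2 z

/-- The state reached when the machine, started in the state `p`, removes the letters of `z` one
after the other; halting states are never left. -/
def stateAfter : P → List Bool → P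
  | p, [] => p
  | p, x :: z =>
    match Q.step p with
    | none => stateAfter p z
    | some f => stateAfter (f x).2 z

variable {Q}

theorem dom_of_halting {p : P} (h : Q.step p = none) (u : List Bool) :
    (eval Q.next (p, u)).Dom :=
  Part.dom_iff_mem.2 ⟨_, mem_eval.2 ⟨Relation.ReflTransGen.refl, next_of_halting h u⟩⟩

theorem dom_nil (p : P) : (eval Q.next (p, [])).Dom :=
  Part.dom_iff_mem.2 ⟨_, mem_eval.2 ⟨Relation.ReflTransGen.refl, rfl⟩⟩

/-- If the letters removed from the queue agree with the letters that are on the queue until the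
machine halts, then the machine halts. -/
theorem dom_of_isPrefix {w : List Bool} (z : List Bool) {p : P} {u : List Bool} (hz : z <+: w)
    (hu : u ++ Q.output p z <+: w) (h : Q.step (Q.stateAfter p z) = none) :
    (eval Q.next (p, u)).Dom := by
  induction z generalizing w p u with
  | nil => exact dom_of_halting h u
  | cons x z ih =>
    cases hp : Q.step p with
    | none => exact dom_of_halting hp u
    | some f =>
      cases u with
      | nil => exact dom_nil p
      | cons y u =>
        simp only [output, stateAfter, hp] at hu h
        obtain ⟨w, rfl⟩ : ∃ w', w = x :: w' := by
          obtain ⟨v, rfl⟩ := hz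
          exact ⟨_, rfl⟩
        rw [List.cons_prefix_cons] at hz
        rw [List.cons_append, List.cons_prefix_cons] at hu
        obtain ⟨rfl, hu⟩ := hu
        rw [reaches_eval (Relation.ReflTransGen.single (mem_next hp y u))]
        exact ih hz.2 (by simpa using hu) h

theorem exists_output_of_reaches {p p' : P} {u u' : List Bool}
    (h : Reaches Q.next (p, u) (p', u')) :
    ∃ z, u ++ Q.output p z = z ++ u' ∧ Q.stateAfter p z = p' := by
  generalize hc : (p, u) = c at h
  induction h using Relation.ReflTransGen.head_induction_on generalizing p u with
  | refl =>
    obtain ⟨rfl, rfl⟩ := Prod.mk.inj hc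
    exact ⟨[], by simp [output], rfl⟩
  | head hs _ ih =>
    subst hc
    cases u with
    | nil => simp [next] at hs
    | cons x u =>
      cases hp : Q.step p with
      | none => simp [next, hp] at hs
      | some f =>
        simp only [next, hp, Option.map_some, Option.mem_def, Option.some.injEq] at hs
        obtain ⟨z, hz, hz'⟩ := ih hs
        exact ⟨x :: z, by simpa [output, hp] using hz, by simpa [stateAfter, hp] using hz'⟩

theorem output_append_of_halting {p : P} {z : List Bool} (h : Q.step (Q.stateAfter p z) = none)
    (v : List Bool) : Q.output p (z ++ v) = Q.output p z := by
  induction z generalizing p with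
  | nil =>
    replace h : Q.step p = none := h
    induction v with
    | nil => rfl
    | cons x v ih => simpa [output, h] using ih
  | cons x z ih =>
    cases hp : Q.step p with
    | none =>
      simp only [stateAfter, hp] at h
      simpa [output, hp] using ih h
    | some f =>
      simp only [stateAfter, hp] at h
      simpa [output, hp] using ih h

theorem stateAfter_append_of_halting {p : P} {z : List Bool}
    (h : Q.step (Q.stateAfter p z) = none) (v : List Bool) :
    Q.stateAfter p (z ++ v) = Q.stateAfter p z := by
  induction z generalizing p with
  | nil =>
    replace h : Q.step p = none := h
    induction v with
    | nil => rfl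
    | cons x v ih => simpa [stateAfter, h] using ih
  | cons x z ih =>
    cases hp : Q.step p with
    | none =>
      simp only [stateAfter, hp] at h
      simpa [stateAfter, hp] using ih h
    | some f =>
      simp only [stateAfter, hp] at h
      simpa [stateAfter, hp] using ih h

end QueueMachine

/-- The states of the automaton verifying computations of a queue machine. -/
inductive CheckState (P : Type)
  | palindrome
  | expect (x : Bool)
  | dead
  | skip
  | simulate (p : P) (l : List Bool)

instance {P : Type} [Countable P] : Countable (CheckState P) :=
  Function.Surjective.countable
    (f := fun s : Option (Option (Bool ⊕ Option (P × List Bool))) => match s with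
      | none => CheckState.palindrome
      | some none => .dead
      | some (some (.inl x)) => .expect x
      | some (some (.inr none)) => .skip
      | some (some (.inr (some (p, l)))) => .simulate p l)
    (by
      rintro (_ | x | _ | _ | ⟨p, l⟩)
      · exact ⟨none, rfl⟩
      · exact ⟨some (some (.inl x)), rfl⟩
      · exact ⟨some none, rfl⟩
      · exact ⟨some (some (.inr none)), rfl⟩
      · exact ⟨some (some (.inr (some (p, l)))), rfl⟩)

namespace QueueMachine

variable {P : Type} (Q : QueueMachine Bool P) (p₀ : P)

open CheckState LinearAutomaton

/-- From `palindrome` this automaton accepts the palindromes, from `skip` the words `u ++ v` with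
`u = 1 ⋯ 1 0` and `v = output p₀ z ++ z.reverse` where `z` leads `Q` from `p₀` to a halting state,
and from `dead` nothing. -/
def checker : LinearAutomaton (CheckState P) where
  right
    | expect _ => true
    | simulate _ [] => true
    | _ => false
  next
    | palindrome, x => expect x
    | expect x, y => if x = y then palindrome else dead
    | dead, _ => dead
    | skip, x => if x then skip else simulate p₀ []
    | simulate p [], x =>
      match Q.step p with
      | none => simulate p []
      | some f => simulate (f x).2 (f x).1
    | simulate p (y :: l), x => if x = y then simulate p l else dead
  final
    | palindrome => True
    | expect _ => True
    | simulate p [] => Q.step p = none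
    | _ => False

theorem not_final_run_dead (w : List Bool) :
    ¬ (Q.checker p₀).final ((Q.checker p₀).run dead w) := by
  induction w with
  | nil => simp [checker]
  | cons x w ih => rwa [run_cons _ rfl]

theorem final_run_palindrome (w : List Bool) :
    (Q.checker p₀).final ((Q.checker p₀).run palindrome w) ↔ w.reverse = w := by
  induction w using List.bidirectionalRec with
  | nil => simp [checker]
  | singleton x =>
    rw [run_cons _ rfl]
    simp [checker]
  | cons_append x w y ih =>
    have h : (Q.checker p₀).run palindrome (x :: (w ++ [y])) =
        (Q.checker p₀).run (if x = y then palindrome else dead) w := by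
      rw [run_cons _ rfl]
      exact run_concat (Q.checker p₀) (q := expect x) rfl y w
    rw [h]
    by_cases hxy : x = y
    · subst hxy
      simp [ih]
    · rw [if_neg hxy]
      refine iff_of_false (not_final_run_dead Q p₀ w) ?_
      simp [Ne.symm hxy]

theorem final_run_simulate (w : List Bool) (p : P) (l : List Bool) :
    (Q.checker p₀).final ((Q.checker p₀).run (simulate p l) w) ↔
      ∃ z, w = l ++ Q.output p z ++ z.reverse ∧ Q.step (Q.stateAfter p z) = none := by
  induction hn : w.length generalizing w p l with
  | zero =>
    obtain rfl := List.length_eq_zero_iff.1 hn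
    cases l with
    | nil =>
      simp only [run_nil, List.nil_append]
      constructor
      · exact fun h => ⟨[], rfl, h⟩
      · rintro ⟨z, hz, h⟩
        obtain rfl : z = [] := by simpa using (List.append_eq_nil_iff.1 hz.symm).2
        exact h
    | cons y l => simp [checker]
  | succ n ih =>
    cases l with
    | cons y l =>
      obtain ⟨x, w, rfl⟩ := List.exists_cons_of_length_eq_add_one hn
      rw [run_cons _ rfl]
      by_cases hxy : x = y
      · subst hxy
        simpa [checker] using ih w p l (by simpa using hn)
      · have h : (Q.checker p₀).next (simulate p (y :: l)) x = dead := if_neg hxy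
        rw [h]
        refine iff_of_false (not_final_run_dead Q p₀ w) ?_
        simp [hxy]
    | nil =>
      have hne : w ≠ [] := by rintro rfl; simp at hn
      obtain ⟨w, x, rfl⟩ := (List.eq_nil_or_concat w).resolve_left hne
      rw [List.concat_eq_append] at hn ⊢
      have hw : w.length = n := by simpa using hn
      rw [run_concat _ rfl]
      cases hp : Q.step p with
      | none =>
        have h : (Q.checker p₀).next (simulate p []) x = simulate p [] := by
          simp [checker, hp]
        rw [h, ih w p [] hw]
        have ho (z : List Bool) : Q.output p z = [] :=
          output_append_of_halting (z := []) hp z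
        have hs (z : List Bool) : Q.stateAfter p z = p :=
          stateAfter_append_of_halting (z := []) hp z
        simp only [ho, hs, hp, and_true, List.append_nil, List.nil_append]
        exact iff_of_true ⟨w.reverse, by simp⟩ ⟨(w ++ [x]).reverse, by simp⟩
      | some f =>
        have h : (Q.checker p₀).next (simulate p []) x = simulate (f x).2 (f x).1 := by
          simp [checker, hp]
        rw [h, ih w _ _ hw]
        constructor
        · rintro ⟨z, rfl, hz⟩
          exact ⟨x :: z, by simp [output, hp], by simpa [stateAfter, hp] using hz⟩
        · rintro ⟨z, hz, hz'⟩
          cases z with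
          | nil => simp [stateAfter, hp] at hz'
          | cons y z =>
            have hz₂ : w ++ [x] = (f y).1 ++ Q.output (f y).2 z ++ z.reverse ++ [y] := by
              simpa [output, hp] using hz
            obtain ⟨rfl, hxy⟩ := List.append_inj' hz₂ rfl
            obtain rfl : x = y := by simpa using hxy
            exact ⟨z, rfl, by simpa [stateAfter, hp] using hz'⟩

theorem run_skip (n : ℕ) (w : List Bool) :
    (Q.checker p₀).run skip (List.replicate n true ++ false :: w) =
      (Q.checker p₀).run (simulate p₀ []) w := by
  induction n with
  | zero => rw [List.replicate_zero, List.nil_append, run_cons _ rfl]; rfl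
  | succ n ih =>
    rw [List.replicate_succ, List.cons_append, run_cons _ rfl, ← ih]
    rfl

open Turing StateTransition

theorem exists_final_iff_dom {n : ℕ} (h : (eval Q.next (p₀, List.replicate n true ++ [false])).Dom →
      ∃ p u, Reaches Q.next (p₀, List.replicate n true ++ [false]) (p, u) ∧ Q.step p = none) :
    (∃ y, (Q.checker p₀).final
        ((Q.checker p₀).run palindrome (List.replicate n true ++ [false] ++ y)) ∧
      (Q.checker p₀).final
        ((Q.checker p₀).run skip (List.replicate n true ++ [false] ++ y))) ↔
    (eval Q.next (p₀, List.replicate n true ++ [false])).Dom := by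
  have hskip (y : List Bool) : (Q.checker p₀).run skip (List.replicate n true ++ [false] ++ y) =
      (Q.checker p₀).run (simulate p₀ []) y := by
    simpa using run_skip Q p₀ n y
  simp only [final_run_palindrome, hskip, final_run_simulate, List.nil_append]
  constructor
  · rintro ⟨_, hpal, z, rfl, hz⟩
    refine dom_of_isPrefix (w := List.replicate n true ++ [false] ++
      (Q.output p₀ z ++ z.reverse)) z ?_ ⟨z.reverse, by simp⟩ hz
    rw [← hpal]
    simp
  · intro hd
    obtain ⟨p, u, hr, hp⟩ := h hd
    obtain ⟨z, hz, rfl⟩ := exists_output_of_reaches hr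
    refine ⟨Q.output p₀ (z ++ u) ++ (z ++ u).reverse, ?_, z ++ u, rfl, ?_⟩
    · rw [output_append_of_halting hp, ← List.append_assoc, hz]
      simp
    · rwa [stateAfter_append_of_halting hp]

theorem exists_finset_closed [Finite P] : ∃ S : Finset (CheckState P),
    (∀ q ∈ S, ∀ x, (Q.checker p₀).next q x ∈ S) ∧ palindrome ∈ S ∧ skip ∈ S ∧ dead ∈ S := by
  obtain ⟨N, hN⟩ : ∃ N, ∀ s : P × Bool, ∀ f ∈ Q.step s.1, (f s.2).1.length ≤ N := by
    obtain ⟨N, hN⟩ := (Set.finite_range fun s : P × Bool =>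
      ((Q.step s.1).map fun f => (f s.2).1.length).getD 0).bddAbove
    refine ⟨N, fun s f hf => hN ⟨s, ?_⟩⟩
    simp [Option.mem_def.1 hf]
  have hfin : ({palindrome, expect true, expect false, dead, skip} ∪
      (fun s : P × List Bool => simulate s.1 s.2) ''
        (Set.univ ×ˢ {l | l.length ≤ N})).Finite :=
    (Set.toFinite _).union ((Set.finite_univ.prod (List.finite_length_le Bool N)).image _)
  refine ⟨hfin.toFinset, ?_, by simp, by simp, by simp⟩
  have hsim (p : P) (l : List Bool) : simulate p l ∈ hfin.toFinset ↔ l.length ≤ N := by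
    simp
  have hdead : (dead : CheckState P) ∈ hfin.toFinset := by simp
  intro q hq x
  cases q with
  | palindrome => cases x <;> simp [checker]
  | expect y =>
    by_cases h : y = x <;> simp [checker, h]
  | dead => exact hdead
  | skip => cases x <;> simp [checker]
  | simulate p l =>
    rw [hsim] at hq
    cases l with
    | nil =>
      cases hp : Q.step p with
      | none =>
        have h : (Q.checker p₀).next (simulate p []) x = simulate p [] := by simp [checker, hp]
        rw [h, hsim]
        exact hq
      | some f =>
        have h : (Q.checker p₀).next (simulate p []) x = simulate (f x).2 (f x).1 := by
          simp [checker, hp]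
        rw [h, hsim]
        exact hN (p, x) f hp
    | cons y l =>
      by_cases h : x = y
      · have h' : (Q.checker p₀).next (simulate p (y :: l)) x = simulate p l := if_pos h
        rw [h', hsim]
        exact (Nat.le_succ _).trans hq
      · have h' : (Q.checker p₀).next (simulate p (y :: l)) x = dead := if_neg h
        rwa [h']

end QueueMachine

theorem computable_enc_cons_replicate {T : Type} [Encodable T] (i N : ℕ) (s : ℕ ⊕ T)
    (v : List (ℕ ⊕ T)) (R : List (ℕ × List (ℕ ⊕ T))) :
    Computable fun n : ℕ => (CFG.mk i ((N, List.replicate n s ++ v) :: R)).enc := by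
  have h₁ : Primrec fun n : ℕ =>
      (fun c => (Nat.pair (Encodable.encode s) c).succ)^[n] (Encodable.encode v) :=
    Primrec.nat_iterate Primrec.id (Primrec.const _)
      (Primrec.succ.comp (Primrec₂.natPair.comp (Primrec.const _) Primrec.snd)).to₂
  have h₂ (n : ℕ) : (fun c => (Nat.pair (Encodable.encode s) c).succ)^[n] (Encodable.encode v) =
      Encodable.encode (List.replicate n s ++ v) := by
    induction n with
    | zero => rfl
    | succ n ih =>
      rw [Function.iterate_succ_apply', ih, List.replicate_succ, List.cons_append,
        Encodable.encode_list_cons]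
  have h₃ : Primrec fun n : ℕ => Nat.pair i
      (Nat.pair (Nat.pair N (Encodable.encode (List.replicate n s ++ v)))
        (Encodable.encode R)).succ :=
    Primrec₂.natPair.comp (Primrec.const _) (Primrec.succ.comp (Primrec₂.natPair.comp
      (Primrec₂.natPair.comp (Primrec.const _) (h₁.of_eq h₂)) (Primrec.const _)))
  exact h₃.to_comp.of_eq fun n => by simp [CFG.enc]

/-- **Statement 19** (Undecidability of CFG equivalence).  For any terminal alphabet
with at least two symbols, no computable (Boolean-valued) function decides, from the
codes of two context-free grammars, whether they generate the same language. -/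
theorem cfg_equivalence_undecidable (T : Type) [Encodable T]
    (a b : T) (hab : a ≠ b) :
    ¬ ∃ f : ℕ → ℕ → Bool, Computable₂ f ∧
        ∀ G G' : CFG T, (f G.enc G'.enc = true ↔ G.language = G'.language) := by
  rintro ⟨f, hf, hfG⟩
  obtain ⟨P, _, Q, p₀, hQ, hundec⟩ := QueueMachine.exists_halting
  obtain ⟨S, hS, hpal, hskip, hdead⟩ := Q.exists_finset_closed p₀
  obtain ⟨e, he⟩ := exists_injective_nat (CheckState P)
  let t : Bool → T := fun x => if x then a else b
  have ht : Function.Injective t := by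
    intro x y h
    cases x <;> cases y <;> simp_all [t, hab.symm]
  let A := Q.checker p₀
  let I : List (List Bool × CheckState P) := [([], .palindrome), ([], .skip)]
  let u : ℕ → List Bool := fun n => List.replicate n true ++ [false]
  let G : ℕ → CFG T := fun n => A.grammar t e S ((u n, .dead) :: I)
  let G' : CFG T := A.grammar t e S I
  have hI : ∀ i ∈ I, i.2 ∈ S := by simp [I, hpal, hskip]
  have hG (n : ℕ) : (G n).language = G'.language ↔
      ¬ (StateTransition.eval Q.next (p₀, u n)).Dom := by
    rw [← Q.exists_final_iff_dom p₀ (hQ n), LinearAutomaton.language_grammar he hS hI,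
      LinearAutomaton.language_grammar he hS (by simpa [hdead] using hI)]
    constructor
    · rintro h ⟨y, hy₁, hy₂⟩
      obtain ⟨i, hi, w, hw, hf⟩ := h.subset ⟨(u n, .dead), List.mem_cons_self, y, rfl,
        Q.not_final_run_dead p₀ y⟩
      replace hw : u n ++ y = i.1 ++ w := ht.list_map hw
      simp only [I, List.mem_cons, List.not_mem_nil, or_false] at hi
      obtain rfl | rfl := hi <;> rw [List.nil_append] at hw <;> subst hw
      · exact hf hy₁
      · exact hf hy₂
    · intro h
      apply Set.Subset.antisymm
      · rintro _ ⟨i, hi, w, rfl, hw⟩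
        obtain rfl | hi := List.mem_cons.1 hi
        · obtain hf | hf := not_and_or.1 (not_exists.1 h w)
          · exact ⟨([], .palindrome), by simp [I], u n ++ w, rfl, hf⟩
          · exact ⟨([], .skip), by simp [I], u n ++ w, rfl, hf⟩
        · exact ⟨i, hi, w, rfl, hw⟩
      · rintro _ ⟨i, hi, w, rfl, hw⟩
        exact ⟨i, List.mem_cons_of_mem _ hi, w, rfl, hw⟩
  have hGenc : Computable fun n => (G n).enc := by
    refine (computable_enc_cons_replicate 0 0 (Sum.inr a) [Sum.inr b, Sum.inl (e .dead + 1)]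
      G'.rules).of_eq fun n => ?_
    simp [G, G', LinearAutomaton.grammar, LinearAutomaton.initialProduction, u, t]
  have hdec : ComputablePred fun n => (G n).language = G'.language :=
    ComputablePred.computable_iff.2
      ⟨fun n => f (G n).enc G'.enc, hf.comp hGenc (Computable.const _),
        funext fun n => propext (hfG (G n) G').symm⟩
  exact hundec ((hdec.of_eq hG).not.of_eq fun n => not_not)
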